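/- Let G = (N, A) be a d-regular graph with d ≥ 1 and let κ be an integer with 1 ≤ κ ≤ |N|. Construct the election with candidates C = N ∪ {p}, where p is a fresh candidate, and votes V: 2d−1 copies of the vote {p} and, for each edge {u, u'} ∈ A, two copies of the vote {u, u'}. Then G has an independent set of size κ if and only if p is not contained in any PAV winning κ-committee of (C, V). -/

import Mathlib

open Finset

attribute [local instance] Classical.propDecidable

universe u

variable {α : Type u}

/-- The Thiele ω-score of a committee `w` in the election with votes `V`. -/
noncomputable def thieleScore [DecidableEq α] (ω : ℕ → ℝ) (V : Multiset (Finset α))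
    (w : Finset α) : ℝ :=
  (V.map fun v => ω (v ∩ w).card).sum

/-- The ω margin contribution of candidate `c` to committee `w`. -/
noncomputable def marginContrib [DecidableEq α] (ω : ℕ → ℝ) (V : Multiset (Finset α))
    (w : Finset α) (c : α) : ℝ :=
  thieleScore ω V (insert c w) - thieleScore ω V w

/-- Candidates of `C \ w` whose ω margin contribution to `w` is maximum. -/
noncomputable def maxMarginSet [DecidableEq α] (ω : ℕ → ℝ) (V : Multiset (Finset α))
    (C w : Finset α) : Finset α :=
  (C \ w).filter fun c => ∀ c' ∈ C \ w, marginContrib ω V w c' ≤ marginContrib ω V w c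

/-- Among the maximizers, the candidate(s) earliest in the tie-breaking order `pri`
(the order with `a ⊳ b` iff `pri a < pri b`). -/
noncomputable def seqNext [DecidableEq α] (ω : ℕ → ℝ) (pri : α → ℕ) (V : Multiset (Finset α))
    (C w : Finset α) : Finset α :=
  (maxMarginSet ω V C w).filter fun c => ∀ c' ∈ maxMarginSet ω V C w, pri c ≤ pri c'

/-- The winning `k`-committee of the sequential ω-Thiele rule with tie-breaking order `pri`:
starting from `∅`, repeatedly add the candidate with maximum ω margin contribution,
breaking ties in favor of the candidate earliest in the order. -/
noncomputable def seqCommittee [DecidableEq α] (ω : ℕ → ℝ) (pri : α → ℕ)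
    (V : Multiset (Finset α)) (C : Finset α) : ℕ → Finset α
  | 0 => ∅
  | k + 1 => seqCommittee ω pri V C k ∪ seqNext ω pri V C (seqCommittee ω pri V C k)

/-- The AV score of a committee. -/
noncomputable def avScore [DecidableEq α] (V : Multiset (Finset α)) (w : Finset α) : ℕ :=
  (V.map fun v => (v ∩ w).card).sum

/-- AV winning `k`-committees: the `k`-subsets of `C` of maximum AV score. -/
noncomputable def avWinners [DecidableEq α] (C : Finset α) (V : Multiset (Finset α)) (k : ℕ) :
    Finset (Finset α) :=
  (C.powersetCard k).filter fun w => ∀ w' ∈ C.powersetCard k, avScore V w' ≤ avScore V w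

/-- The SAV score of a committee. -/
noncomputable def savScore [DecidableEq α] (V : Multiset (Finset α)) (w : Finset α) : ℝ :=
  (V.map fun v => ((w ∩ v).card : ℝ) / (v.card : ℝ)).sum

/-- SAV winning `k`-committees: the `k`-subsets of `C` of maximum SAV score. -/
noncomputable def savWinners [DecidableEq α] (C : Finset α) (V : Multiset (Finset α)) (k : ℕ) :
    Finset (Finset α) :=
  (C.powersetCard k).filter fun w => ∀ w' ∈ C.powersetCard k, savScore V w' ≤ savScore V w

/-- The NSAV score of a committee (with respect to candidate set `C`). -/
noncomputable def nsavScore [DecidableEq α] (C : Finset α) (V : Multiset (Finset α))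
    (w : Finset α) : ℝ :=
  (V.map fun v => ((w ∩ v).card : ℝ) / (v.card : ℝ)).sum
    - (V.map fun v => ((w \ v).card : ℝ) / ((C \ v).card : ℝ)).sum

/-- The PAV score of a committee. -/
noncomputable def pavScore [DecidableEq α] (V : Multiset (Finset α)) (w : Finset α) : ℝ :=
  (V.map fun v => ∑ i ∈ Finset.range (v ∩ w).card, (1 : ℝ) / (i + 1)).sum

/-- PAV winning `k`-committees: the `k`-subsets of `C` of maximum PAV score. -/
noncomputable def pavWinners [DecidableEq α] (C : Finset α) (V : Multiset (Finset α)) (k : ℕ) :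
    Finset (Finset α) :=
  (C.powersetCard k).filter fun w => ∀ w' ∈ C.powersetCard k, pavScore V w' ≤ pavScore V w

/-- The ABCCV score of a committee: the number of votes approving at least one member. -/
noncomputable def abccvScore [DecidableEq α] (V : Multiset (Finset α)) (w : Finset α) : ℕ :=
  Multiset.card (V.filter fun v => (v ∩ w).Nonempty)

/-- ABCCV winning `k`-committees: the `k`-subsets of `C` of maximum ABCCV score. -/
noncomputable def abccvWinners [DecidableEq α] (C : Finset α) (V : Multiset (Finset α)) (k : ℕ) :
    Finset (Finset α) :=
  (C.powersetCard k).filter fun w => ∀ w' ∈ C.powersetCard k, abccvScore V w' ≤ abccvScore V w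

/-- The MAV score of a committee: the maximum Hamming distance to a vote. -/
noncomputable def mavScore [DecidableEq α] (V : Multiset (Finset α)) (w : Finset α) : ℕ :=
  (V.map fun v => (w \ v).card + (v \ w).card).sup

/-- MAV winning `k`-committees: the `k`-subsets of `C` of minimum MAV score. -/
noncomputable def mavWinners [DecidableEq α] (C : Finset α) (V : Multiset (Finset α)) (k : ℕ) :
    Finset (Finset α) :=
  (C.powersetCard k).filter fun w => ∀ w' ∈ C.powersetCard k, mavScore V w ≤ mavScore V w'

namespace Stmt9

variable {β : Type u} [DecidableEq β]

/-- Candidate type: a vertex of the graph, or the distinguished candidate `p`. -/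
abbrev Cand (β : Type u) := β ⊕ Unit

/-- The distinguished candidate `p`. -/
def pc : Cand β := Sum.inr ()

/-- The candidate set `C = N ∪ {p}`. -/
def Ctot (N : Finset β) : Finset (Cand β) := insert pc (N.image Sum.inl)

/-- The votes: `2d − 1` copies of `{p}` and two copies of the vote `{u, u'}` per
edge `{u, u'}`. -/
def votes (d : ℕ) (Aed : Finset (Finset β)) : Multiset (Finset (Cand β)) :=
  Multiset.replicate (2 * d - 1) ({pc} : Finset (Cand β))
    + Aed.val.bind (fun e => Multiset.replicate 2 (e.image Sum.inl))

theorem pav_score_votes (d : ℕ) (hd : 1 ≤ d)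
    (N : Finset β) (Aed : Finset (Finset β))
    (hedge : ∀ e ∈ Aed, e.card = 2 ∧ e ⊆ N)
    (hreg : ∀ u ∈ N, (Aed.filter fun e => u ∈ e).card = d)
    (w : Finset (Cand β)) (S : Finset β) (hSN : S ⊆ N)
    (hS : ∀ u ∈ N, Sum.inl u ∈ w ↔ u ∈ S) :
    pavScore (votes d Aed) w =
      (if (pc : Cand β) ∈ w then (2 * (d : ℝ) - 1) else 0) + 2 * d * S.card
        - ((Aed.filter fun e => e ⊆ S).card : ℝ) := by
  have hterm : ∀ e ∈ Aed,
      2 * (∑ i ∈ Finset.range ((e.image Sum.inl : Finset (Cand β)) ∩ w).card, (1 : ℝ) / (i + 1))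
        = 2 * ((S ∩ e).card : ℝ) - (if e ⊆ S then 1 else 0) := by
    intro e he
    obtain ⟨h2, hN⟩ := hedge e he
    have h1 : (e.image Sum.inl : Finset (Cand β)) ∩ w = (S ∩ e).image Sum.inl := by
      ext c
      simp only [Finset.mem_inter, Finset.mem_image]
      constructor
      · rintro ⟨⟨u, hu, rfl⟩, hw⟩
        exact ⟨u, ⟨(hS u (hN hu)).1 hw, hu⟩, rfl⟩
      · rintro ⟨u, ⟨huS, hu⟩, rfl⟩
        exact ⟨⟨u, hu, rfl⟩, (hS u (hN hu)).2 huS⟩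
    rw [h1, Finset.card_image_of_injective _ Sum.inl_injective]
    have hle : (S ∩ e).card ≤ 2 := h2 ▸ Finset.card_le_card Finset.inter_subset_right
    by_cases hsub : e ⊆ S
    · rw [Finset.inter_eq_right.2 hsub, h2, if_pos hsub]
      norm_num [Finset.sum_range_succ]
    · have hne : (S ∩ e).card ≠ 2 := by
        intro h
        apply hsub
        have := Finset.eq_of_subset_of_card_le (Finset.inter_subset_right : S ∩ e ⊆ e) (by omega)
        exact Finset.inter_eq_right.1 this
      rw [if_neg hsub]
      have : (S ∩ e).card = 0 ∨ (S ∩ e).card = 1 := by omega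
      rcases this with h | h <;> rw [h] <;> norm_num
  have hcount : (∑ e ∈ Aed, (S ∩ e).card) = S.card * d := by
    apply Finset.sum_card_inter
    intro a ha
    convert hreg a (hSN ha)
  have hcount' : (∑ e ∈ Aed, ((S ∩ e).card : ℝ)) = S.card * d := by exact_mod_cast hcount
  have hp : (∑ i ∈ Finset.range (({pc} : Finset (Cand β)) ∩ w).card, (1 : ℝ) / (i + 1))
      = if (pc : Cand β) ∈ w then 1 else 0 := by
    by_cases h : (pc : Cand β) ∈ w
    · rw [Finset.singleton_inter_of_mem h, if_pos h]; norm_num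
    · rw [Finset.singleton_inter_of_notMem h, if_neg h]; norm_num
  have hsum : (Multiset.map (fun v : Finset (Cand β) =>
      ∑ i ∈ Finset.range (v ∩ w).card, (1 : ℝ) / (i + 1))
      (Aed.val.bind (fun e => Multiset.replicate 2 (e.image Sum.inl)))).sum
      = ∑ e ∈ Aed, 2 * (∑ i ∈ Finset.range ((e.image Sum.inl : Finset (Cand β)) ∩ w).card,
          (1 : ℝ) / (i + 1)) := by
    rw [Multiset.map_bind, Multiset.sum_bind]
    simp only [Multiset.map_replicate, Multiset.sum_replicate, nsmul_eq_mul, Nat.cast_ofNat]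
    rfl
  unfold pavScore votes
  rw [Multiset.map_add, Multiset.sum_add, hsum, Finset.sum_congr rfl hterm,
    Finset.sum_sub_distrib, ← Finset.mul_sum, hcount', Multiset.map_replicate,
    Multiset.sum_replicate, hp, Finset.sum_boole, nsmul_eq_mul,
    Nat.cast_sub (by omega : 1 ≤ 2 * d)]
  split_ifs <;> push_cast <;> ring

/-- A committee is determined by its vertices and whether it holds `p`. -/
theorem committee_form (N : Finset β) (w : Finset (Cand β)) (hw : w ⊆ Ctot N) :
    ∃ S ⊆ N, (∀ u ∈ N, Sum.inl u ∈ w ↔ u ∈ S) ∧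
      w.card = S.card + (if (pc : Cand β) ∈ w then 1 else 0) := by
  refine ⟨N.filter (fun u => Sum.inl u ∈ w), Finset.filter_subset _ _, ?_, ?_⟩
  · intro u hu; simp [hu]
  · have h1 : (N.filter (fun u => (Sum.inl u : Cand β) ∈ w)).image Sum.inl = w.erase pc := by
      ext c
      simp only [Finset.mem_image, Finset.mem_filter, Finset.mem_erase]
      constructor
      · rintro ⟨u, ⟨_, h⟩, rfl⟩
        exact ⟨by simp [pc], h⟩
      · rintro ⟨hne, hc⟩
        have := hw hc
        simp only [Ctot, Finset.mem_insert, Finset.mem_image] at this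
        rcases this with h | ⟨u, hu, rfl⟩
        · exact absurd h hne
        · exact ⟨u, ⟨hu, hc⟩, rfl⟩
    have h2 := congrArg Finset.card h1
    rw [Finset.card_image_of_injective _ Sum.inl_injective] at h2
    rw [h2]
    split_ifs with h
    · exact (Finset.card_erase_add_one h).symm
    · rw [Finset.erase_eq_of_notMem h]; rfl

/-- correctness of the reduction from Independent Set on `d`-regular graphs
to Nonwinning Testing for PAV. -/
theorem nonwinning_pav (d : ℕ) (hd : 1 ≤ d)
    (N : Finset β) (Aed : Finset (Finset β))
    (hedge : ∀ e ∈ Aed, e.card = 2 ∧ e ⊆ N)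
    (hreg : ∀ u ∈ N, (Aed.filter fun e => u ∈ e).card = d)
    (κ : ℕ) (hκ1 : 1 ≤ κ) (hκ2 : κ ≤ N.card) :
    (∃ S ⊆ N, S.card = κ ∧ ∀ e ∈ Aed, ¬ e ⊆ S) ↔
      (∀ w ∈ pavWinners (Ctot N) (votes d Aed) κ, pc ∉ w) := by
  have hCcard : (Ctot N).card = N.card + 1 := by
    unfold Ctot
    rw [Finset.card_insert_of_notMem (by simp [pc]),
      Finset.card_image_of_injective _ Sum.inl_injective]
  constructor
  · rintro ⟨S, hSN, hSc, hind⟩ w hw hp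
    simp only [pavWinners, Finset.mem_filter, Finset.mem_powersetCard] at hw
    obtain ⟨⟨hwC, hwk⟩, hmax⟩ := hw
    have h1 := hmax (S.image Sum.inl)
      ⟨(Finset.image_subset_image hSN).trans (Finset.subset_insert _ _),
        by rw [Finset.card_image_of_injective _ Sum.inl_injective, hSc]⟩
    obtain ⟨T, hTN, hT, hTc⟩ := committee_form N w hwC
    rw [if_pos hp] at hTc
    rw [pav_score_votes d hd N Aed hedge hreg w T hTN hT,
      pav_score_votes d hd N Aed hedge hreg (S.image Sum.inl) S hSN (by intro u _; simp),
      if_pos hp, if_neg (by simp [pc]), Finset.filter_false_of_mem hind] at h1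
    have h3 : (S.card : ℝ) = T.card + 1 := by exact_mod_cast (by omega)
    have h4 : (0 : ℝ) ≤ ((Aed.filter fun e => e ⊆ T).card : ℝ) := Nat.cast_nonneg _
    rw [h3] at h1
    simp only [Finset.card_empty, Nat.cast_zero] at h1
    nlinarith
  · intro h
    by_contra hno
    push Not at hno
    have hne : ((Ctot N).powersetCard κ).Nonempty :=
      Finset.powersetCard_nonempty.2 (by omega)
    obtain ⟨w, hw, hmax⟩ := Finset.exists_max_image _ (pavScore (votes d Aed)) hne
    have hpw : (pc : Cand β) ∉ w := h w (by
      simp only [pavWinners, Finset.mem_filter]; exact ⟨hw, hmax⟩)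
    rw [Finset.mem_powersetCard] at hw
    obtain ⟨hwC, hwk⟩ := hw
    obtain ⟨T, hTN, hT, hTc⟩ := committee_form N w hwC
    rw [if_neg hpw, add_zero] at hTc
    obtain ⟨e, he, heT⟩ := hno T hTN (by omega)
    obtain ⟨u, hu⟩ : e.Nonempty := Finset.card_pos.1 (by rw [(hedge e he).1]; norm_num)
    have huT := heT hu
    have huN := hTN huT
    let w' : Finset (Cand β) := insert pc ((T.erase u).image Sum.inl)
    have hpw' : (pc : Cand β) ∈ w' := Finset.mem_insert_self _ _
    have hTu : (T.erase u).card + 1 = T.card := Finset.card_erase_add_one huT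
    have hw' : w' ∈ (Ctot N).powersetCard κ := by
      rw [Finset.mem_powersetCard]
      refine ⟨Finset.insert_subset_insert _
        (Finset.image_subset_image ((Finset.erase_subset _ _).trans hTN)), ?_⟩
      rw [Finset.card_insert_of_notMem (by simp [pc]),
        Finset.card_image_of_injective _ Sum.inl_injective]
      omega
    have hlt : (Aed.filter fun e => e ⊆ T.erase u).card + 1
        ≤ (Aed.filter fun e => e ⊆ T).card := by
      apply Finset.card_lt_card
      rw [Finset.ssubset_iff_of_subset]
      · refine ⟨e, Finset.mem_filter.2 ⟨he, heT⟩, ?_⟩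
        intro hm
        exact Finset.notMem_erase u T ((Finset.mem_filter.1 hm).2 hu)
      · intro f hf
        rw [Finset.mem_filter] at hf ⊢
        exact ⟨hf.1, hf.2.trans (Finset.erase_subset _ _)⟩
    have hge : pavScore (votes d Aed) w ≤ pavScore (votes d Aed) w' := by
      rw [pav_score_votes d hd N Aed hedge hreg w T hTN hT,
        pav_score_votes d hd N Aed hedge hreg w' (T.erase u)
          ((Finset.erase_subset _ _).trans hTN) (by intro v _; simp [w', pc]),
        if_pos hpw', if_neg hpw]
      have h1 : (T.card : ℝ) = (T.erase u).card + 1 := by exact_mod_cast hTu.symm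
      have h2 : ((Aed.filter fun e => e ⊆ T.erase u).card : ℝ) + 1
        ≤ ((Aed.filter fun e => e ⊆ T).card : ℝ) := by exact_mod_cast hlt
      rw [h1]
      nlinarith
    exact h w' (by
      simp only [pavWinners, Finset.mem_filter]
      exact ⟨hw', fun x hx => (hmax x hx).trans hge⟩) hpw'


end Stmt9
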